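/- For all integers $n \ge 3$, $k \ge 2$, $q \ge 2$, letting $p = q + 1 + x$ where $x \in \{0, 1\}$ is chosen so that $p$ is even (i.e., $x \equiv q+1 \pmod 2$): $\operatorname{Z}_q(C_{n,k}) \le (p - 2)\log_2(n) + p + k - q + q(k-1)$. -/

import Mathlib

open SimpleGraph

namespace ZqGame

variable {V : Type*}

/-- A blue vertex `v` forces the white vertex `w`, where only white vertices in
`Wallow` are taken into account (used for Rule 3, where play is restricted to the
subgraph induced by the blue set together with the returned white components). -/
def ForceIn (G : SimpleGraph V) (B : Set V) (Wallow : Set V) (v w : V) : Prop :=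
  v ∈ B ∧ w ∉ B ∧ w ∈ Wallow ∧ G.Adj v w ∧
    ∀ u, G.Adj v u → u ∉ B → u ∈ Wallow → u = w

/-- The standard color change rule: `v` is blue and `w` is its unique white neighbor. -/
def Force (G : SimpleGraph V) (B : Set V) (v w : V) : Prop :=
  ForceIn G B Set.univ v w

/-- The white connected component of `G - B` containing the white vertex `w`. -/
def WhiteComp (G : SimpleGraph V) (B : Set V) (w : V) : Set V :=
  {x | Relation.ReflTransGen (fun a b => G.Adj a b ∧ a ∉ B ∧ b ∉ B) w x}

/-- `W` is a white component, i.e. a connected component of `G - B`. -/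
def IsWhiteComp (G : SimpleGraph V) (B : Set V) (W : Set V) : Prop :=
  ∃ w, w ∉ B ∧ W = WhiteComp G B w

/-- An active vertex: a blue vertex with at least two white neighbors. -/
def Active (G : SimpleGraph V) (B : Set V) (a : V) : Prop :=
  a ∈ B ∧ ∃ w₁ w₂, w₁ ≠ w₂ ∧ G.Adj a w₁ ∧ G.Adj a w₂ ∧ w₁ ∉ B ∧ w₂ ∉ B

end ZqGame

namespace ZqGame

variable {V : Type*}

/-- `Win G q B t` : in the `Z_q`-forcing game on `G` starting from blue set `B`,
Blue has a strategy spending at most `t` tokens that colors every vertex blue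
against any (adversarial) play by White.
* `all` : every vertex is already blue.
* `rule1` : spend one token to color an arbitrary vertex blue.
* `rule2` : a blue vertex with exactly one white neighbor forces it, for free.
* `rule3` : Blue announces a collection `𝒲` of at least `q + 1` white components;
  for every nonempty sub-collection `𝒮` that White may return, Blue can perform a
  Rule 2 force (`vf 𝒮 → wf 𝒮`) on the subgraph induced by `B` together with `⋃ 𝒮`,
  and continue from the resulting position. -/
inductive Win (G : SimpleGraph V) (q : ℕ) : Set V → ℕ → Prop
  | all (B : Set V) (t : ℕ) : (∀ v, v ∈ B) → Win G q B t
  | rule1 (B : Set V) (t : ℕ) (v : V) : Win G q (insert v B) t → Win G q B (t + 1)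
  | rule2 (B : Set V) (t : ℕ) (v w : V) :
      Force G B v w → Win G q (insert w B) t → Win G q B t
  | rule3 (B : Set V) (t : ℕ) (𝒲 : Finset (Set V))
      (vf wf : Finset (Set V) → V) :
      (∀ W ∈ 𝒲, IsWhiteComp G B W) → q + 1 ≤ 𝒲.card →
      (∀ 𝒮 : Finset (Set V), 𝒮 ⊆ 𝒲 → 𝒮.Nonempty →
        ForceIn G B (⋃₀ (𝒮 : Set (Set V))) (vf 𝒮) (wf 𝒮)) →
      (∀ 𝒮 : Finset (Set V), 𝒮 ⊆ 𝒲 → 𝒮.Nonempty →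
        Win G q (insert (wf 𝒮) B) t) →
      Win G q B t

/-- `Z_q(G, B)` : the minimum number of additional tokens Blue must spend to win the
`Z_q`-forcing game on `G` starting from blue set `B`. -/
noncomputable def cost (G : SimpleGraph V) (q : ℕ) (B : Set V) : ℕ :=
  sInf {t | Win G q B t}

/-- `Z_q(G)` : the `Z_q`-forcing number of `G`. -/
noncomputable def Zq (G : SimpleGraph V) (q : ℕ) : ℕ := cost G q ∅

end ZqGame

namespace ZqGame

/-- Vertex type of a caterpillar cycle: `Sum.inl i` is the `i`-th center (cycle) vertex,
and `Sum.inr ⟨i, j⟩` is the `j`-th pendant leaf attached to center `i`, where center `i`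
has `f i` pendant leaves. -/
abbrev CatVert (n : ℕ) (f : Fin n → ℕ) : Type := Fin n ⊕ (Σ i : Fin n, Fin (f i))

/-- The caterpillar cycle obtained from the cycle `C_n` by attaching `f i` pendant
leaves to the `i`-th cycle vertex. -/
def catCycle (n : ℕ) (f : Fin n → ℕ) : SimpleGraph (CatVert n f) :=
  SimpleGraph.fromRel (fun x y =>
    match x, y with
    | Sum.inl i, Sum.inl j => ((i : ℕ) + 1) % n = (j : ℕ)
    | Sum.inl i, Sum.inr l => i = l.1
    | _, _ => False)

end ZqGame

namespace ZqGame

section General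

variable {V : Type*} {G : SimpleGraph V} {q : ℕ}

theorem Win.mono {B : Set V} {t t' : ℕ} (h : Win G q B t) (htt : t ≤ t') : Win G q B t' := by
  induction h generalizing t' with
  | all B t hB => exact .all _ _ hB
  | rule1 B t v _ ih =>
    obtain ⟨r, rfl⟩ : ∃ r, t' = r + 1 := ⟨t' - 1, by omega⟩
    exact .rule1 _ _ v (ih (by omega))
  | rule2 B t v w hvw _ ih => exact .rule2 _ _ v w hvw (ih htt)
  | rule3 B t 𝒲 vf wf hW hcard hforce _ ih =>
    exact .rule3 _ _ 𝒲 vf wf hW hcard hforce fun 𝒮 hS hne => ih 𝒮 hS hne htt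

/-- Repeated use of Rule 1. -/
theorem Win.of_union_finset {B : Set V} {t : ℕ} (T : Finset V) (h : Win G q (B ∪ ↑T) t) :
    Win G q B (t + T.card) := by
  classical
  induction T using Finset.induction_on generalizing B with
  | empty => simpa using h
  | insert a T ha ih =>
    rw [Finset.card_insert_of_notMem ha, ← add_assoc]
    refine .rule1 _ _ a (ih ?_)
    have hB : insert a B ∪ (T : Set V) = B ∪ ↑(insert a T) := by
      ext y
      simp only [Set.mem_union, Set.mem_insert_iff, Finset.coe_insert, Finset.mem_coe]
      tauto
    rwa [hB]

/-- Rule 3, with Blue's answer to each reply of White given existentially. -/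
theorem Win.of_announce {B : Set V} {t : ℕ} (𝒲 : Finset (Set V))
    (hW : ∀ W ∈ 𝒲, IsWhiteComp G B W) (hcard : q + 1 ≤ 𝒲.card)
    (h : ∀ 𝒮 ⊆ 𝒲, 𝒮.Nonempty →
      ∃ v w, ForceIn G B (⋃₀ (𝒮 : Set (Set V))) v w ∧ Win G q (insert w B) t) :
    Win G q B t := by
  obtain ⟨W, hWm⟩ : 𝒲.Nonempty := Finset.card_pos.1 (by omega)
  obtain ⟨w₀, -, -⟩ := hW W hWm
  have h' : ∀ 𝒮 : Finset (Set V), ∃ v w, 𝒮 ⊆ 𝒲 → 𝒮.Nonempty →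
      ForceIn G B (⋃₀ (𝒮 : Set (Set V))) v w ∧ Win G q (insert w B) t := by
    intro 𝒮
    by_cases hS : 𝒮 ⊆ 𝒲 ∧ 𝒮.Nonempty
    · obtain ⟨v, w, hvw⟩ := h 𝒮 hS.1 hS.2
      exact ⟨v, w, fun _ _ => hvw⟩
    · exact ⟨w₀, w₀, fun h1 h2 => absurd ⟨h1, h2⟩ hS⟩
  choose vf wf hvw using h'
  exact .rule3 _ _ 𝒲 vf wf hW hcard (fun 𝒮 h1 h2 => (hvw 𝒮 h1 h2).1)
    fun 𝒮 h1 h2 => (hvw 𝒮 h1 h2).2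

theorem ncard_compl_insert_lt [Finite V] {B : Set V} {w : V} (hw : w ∉ B) :
    (insert w B)ᶜ.ncard < Bᶜ.ncard :=
  Set.ncard_lt_ncard
    ⟨Set.compl_subset_compl.2 (Set.subset_insert _ _), fun h => h hw (Set.mem_insert _ _)⟩

end General

section Cycle

theorem val_finRotate {n : ℕ} (i : Fin n) : (finRotate n i : ℕ) = (i + 1) % n := by
  cases n with
  | zero => exact i.elim0
  | succ n => simp [Fin.val_add]

theorem val_finRotate_iterate {n : ℕ} (t : ℕ) (i : Fin n) :
    ((finRotate n)^[t] i : ℕ) = (i + t) % n := by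
  induction t with
  | zero => simp [Nat.mod_eq_of_lt i.isLt]
  | succ t ih => rw [Function.iterate_succ_apply', val_finRotate, ih, Nat.mod_add_mod, add_assoc]

theorem exists_finRotate_iterate_eq {n : ℕ} (i j : Fin n) : ∃ t, (finRotate n)^[t] i = j := by
  refine ⟨n - i + j, Fin.ext ?_⟩
  rw [val_finRotate_iterate]
  have := i.isLt
  rw [show (i : ℕ) + (n - i + j) = n + j by omega, Nat.add_mod_left, Nat.mod_eq_of_lt j.isLt]

end Cycle

section Caterpillar

variable {n : ℕ} {f : Fin n → ℕ} {B : Set (CatVert n f)}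

theorem adj_center_center {i j : Fin n} (h : (catCycle n f).Adj (Sum.inl i) (Sum.inl j)) :
    finRotate n i = j ∨ finRotate n j = i := by
  simp only [catCycle, SimpleGraph.fromRel_adj] at h
  rcases h.2 with h | h
  · exact .inl (Fin.ext ((val_finRotate i).trans h))
  · exact .inr (Fin.ext ((val_finRotate j).trans h))

theorem adj_center_next (hn : 2 ≤ n) (i : Fin n) :
    (catCycle n f).Adj (Sum.inl i) (Sum.inl (finRotate n i)) := by
  simp only [catCycle, SimpleGraph.fromRel_adj]
  refine ⟨fun h => ?_, .inl (val_finRotate i).symm⟩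
  have h1 : (i : ℕ) = (i + 1) % n := by
    rw [← val_finRotate, ← Sum.inl.inj h]
  have := i.isLt
  rcases Nat.lt_or_ge (i + 1) n with h2 | h2
  · rw [Nat.mod_eq_of_lt h2] at h1
    omega
  · rw [show (i : ℕ) + 1 = n by omega, Nat.mod_self] at h1
    omega

theorem adj_center_leaf {i : Fin n} {l : Σ i : Fin n, Fin (f i)} :
    (catCycle n f).Adj (Sum.inl i) (Sum.inr l) ↔ i = l.1 := by
  simp [catCycle, SimpleGraph.fromRel_adj]

theorem adj_leaf {l : Σ i : Fin n, Fin (f i)} {y : CatVert n f}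
    (h : (catCycle n f).Adj y (Sum.inr l)) : y = Sum.inl l.1 := by
  rcases y with i | l'
  · rw [adj_center_leaf.1 h]
  · simp [catCycle, SimpleGraph.fromRel_adj] at h

/-- A white leaf of a blue center lies in no white component but its own. -/
theorem eq_of_leaf_mem_whiteComp {l : Σ i : Fin n, Fin (f i)} (hl : Sum.inl l.1 ∈ B)
    {w : CatVert n f} (h : Sum.inr l ∈ WhiteComp (catCycle n f) B w) : w = Sum.inr l := by
  rcases Relation.ReflTransGen.cases_tail h with h | ⟨y, -, hadj, hy, -⟩
  · exact h.symm
  · exact absurd (adj_leaf hadj ▸ hl) hy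

theorem whiteComp_leaf {l : Σ i : Fin n, Fin (f i)} (hl : Sum.inl l.1 ∈ B) :
    WhiteComp (catCycle n f) B (Sum.inr l) = {Sum.inr l} := by
  ext y
  refine ⟨fun h => ?_, fun h => h ▸ Relation.ReflTransGen.refl⟩
  rcases Relation.ReflTransGen.cases_head h with h | ⟨z, ⟨hadj, -, hz⟩, -⟩
  · exact h.symm
  · exact absurd (adj_leaf hadj.symm ▸ hl) hz

/-- The center carrying a vertex. -/
def base : CatVert n f → Fin n := Sum.elim id Sigma.fst

/-- The white component following a blue center only reaches centers of the white run starting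
there. -/
theorem exists_iterate_of_mem_whiteComp {u : Fin n} (hu : Sum.inl u ∈ B)
    (hu' : Sum.inl (finRotate n u) ∉ B) {y : CatVert n f}
    (h : y ∈ WhiteComp (catCycle n f) B (Sum.inl (finRotate n u))) :
    ∃ t, base y = (finRotate n)^[t + 1] u ∧
      ∀ r ≤ t, (Sum.inl ((finRotate n)^[r + 1] u) : CatVert n f) ∉ B := by
  induction h with
  | refl =>
    refine ⟨0, rfl, fun r hr => ?_⟩
    obtain rfl : r = 0 := by omega
    exact hu'
  | @tail y z _ hyz ih =>
    obtain ⟨t, hy, ht⟩ := ih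
    obtain ⟨hadj, -, hz⟩ := hyz
    rcases z with j | l
    · rcases y with i | l'
      · change i = _ at hy
        rcases adj_center_center hadj with h | h
        · refine ⟨t + 1, ?_, fun r hr => ?_⟩
          · change j = _
            rw [Function.iterate_succ_apply', ← hy, h]
          · rcases Nat.lt_or_ge t r with h1 | h1
            · obtain rfl : r = t + 1 := by omega
              rw [Function.iterate_succ_apply', ← hy, h]
              exact hz
            · exact ht r h1
        · have hj : j = (finRotate n)^[t] u := by
            apply (finRotate n).injective
            rw [h, hy, Function.iterate_succ_apply']
          cases t with
          | zero => exact absurd (hj ▸ hu) hz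
          | succ t => exact ⟨t, hj, fun r hr => ht r (by omega)⟩
      · have := adj_leaf hadj.symm
        exact ⟨t, (Sum.inl.inj this).trans hy, ht⟩
    · obtain rfl := adj_leaf hadj
      exact ⟨t, hy, ht⟩

theorem eq_of_whiteComp_eq {u u' : Fin n} (hu : Sum.inl u ∈ B)
    (hv : Sum.inl (finRotate n u) ∉ B) (hu' : Sum.inl u' ∈ B)
    (h : WhiteComp (catCycle n f) B (Sum.inl (finRotate n u)) =
      WhiteComp (catCycle n f) B (Sum.inl (finRotate n u'))) : u = u' := by
  have hmem : Sum.inl (finRotate n u') ∈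
      WhiteComp (catCycle n f) B (Sum.inl (finRotate n u)) := by
    rw [h]
    exact Relation.ReflTransGen.refl
  obtain ⟨t, ht, hr⟩ := exists_iterate_of_mem_whiteComp hu hv hmem
  rw [Function.iterate_succ_apply'] at ht
  have ht' : u' = (finRotate n)^[t] u := (finRotate n).injective ht
  cases t with
  | zero => exact ht'.symm
  | succ t => exact absurd (ht' ▸ hu') (hr t (by omega))

theorem iterate_mem_whiteComp (hn : 2 ≤ n) {u : Fin n} {t : ℕ}
    (h : ∀ r ≤ t, (Sum.inl ((finRotate n)^[r + 1] u) : CatVert n f) ∉ B) :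
    Sum.inl ((finRotate n)^[t + 1] u) ∈
      WhiteComp (catCycle n f) B (Sum.inl (finRotate n u)) := by
  induction t with
  | zero => exact Relation.ReflTransGen.refl
  | succ t ih =>
    refine Relation.ReflTransGen.tail (ih fun r hr => h r (by omega))
      ⟨?_, h t (by omega), h (t + 1) le_rfl⟩
    rw [Function.iterate_succ_apply' _ (t + 1)]
    exact adj_center_next hn _

/-- Every blue center has a blue neighboring center, and every white run of centers has length at
most `2 ^ (m + 1) - 2`. -/
structure Paired (B : Set (CatVert n f)) (m : ℕ) : Prop where
  pair : ∀ i, Sum.inl (finRotate n i) ∈ B →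
    Sum.inl i ∈ B ∨ Sum.inl (finRotate n (finRotate n i)) ∈ B
  gap : ∀ i, ∃ j, j + 2 ≤ 2 ^ (m + 1) ∧ Sum.inl ((finRotate n)^[j] i) ∈ B

namespace Paired

variable {m : ℕ}

theorem insert_leaf (h : Paired B m) (l : Σ i : Fin n, Fin (f i)) :
    Paired (insert (Sum.inr l) B) m where
  pair i hi := by simpa using h.pair i (by simpa using hi)
  gap i := by simpa using h.gap i

theorem insert_center (h : Paired B m) {i : Fin n}
    (hi : Sum.inl (finRotate n i) ∈ B ∨ ∃ j, finRotate n j = i ∧ Sum.inl j ∈ B) :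
    Paired (insert (Sum.inl i) B) m where
  pair j hj := by
    rcases hj with hj | hj
    · obtain rfl := Sum.inl.inj hj
      rcases hi with hi | ⟨j', hj', hi⟩
      · exact .inr (.inr hi)
      · obtain rfl := (finRotate n).injective hj'
        exact .inl (.inr hi)
    · exact (h.pair j hj).imp .inr .inr
  gap j := by
    obtain ⟨r, hr, hB⟩ := h.gap j
    exact ⟨r, hr, .inr hB⟩

/-- Every white center belongs to a white run started by a blue center. -/
theorem exists_run_start (h : Paired B m) {i : Fin n} (hi : Sum.inl i ∉ B) :
    ∃ u t, Sum.inl u ∈ B ∧ (finRotate n)^[t + 1] u = i ∧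
      ∀ r ≤ t, (Sum.inl ((finRotate n)^[r + 1] u) : CatVert n f) ∉ B := by
  classical
  have hex : ∃ t u, Sum.inl u ∈ B ∧ (finRotate n)^[t] u = i := by
    obtain ⟨j, -, hj⟩ := h.gap i
    obtain ⟨t, ht⟩ := exists_finRotate_iterate_eq ((finRotate n)^[j] i) i
    exact ⟨t, _, hj, ht⟩
  obtain ⟨u, hu, hui⟩ := Nat.find_spec hex
  have hmin := fun r => Nat.find_min (m := r) hex
  generalize Nat.find hex = t at hui hmin
  cases t with
  | zero => exact absurd ((show u = i from hui) ▸ hu) hi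
  | succ t =>
    refine ⟨u, t, hu, hui, fun r hr hB => hmin (t - r) (by omega) ⟨_, hB, ?_⟩⟩
    rw [← Function.iterate_add_apply, show t - r + (r + 1) = t + 1 by omega, hui]

/-- The white run started by a blue center ends after boundedly many steps. -/
theorem exists_run_length (h : Paired B m) {u : Fin n} (hu : Sum.inl (finRotate n u) ∉ B) :
    ∃ t, t + 3 ≤ 2 ^ (m + 1) ∧ Sum.inl ((finRotate n)^[t + 2] u) ∈ B ∧
      ∀ r ≤ t, (Sum.inl ((finRotate n)^[r + 1] u) : CatVert n f) ∉ B := by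
  classical
  obtain ⟨j, hj, hjB⟩ := h.gap (finRotate n u)
  rw [← Function.iterate_succ_apply] at hjB
  have hex : ∃ j, Sum.inl ((finRotate n)^[j + 1] u) ∈ B := ⟨j, hjB⟩
  have hle := Nat.find_min' hex hjB
  have hspec := Nat.find_spec hex
  have hmin := fun r => Nat.find_min (m := r) hex
  generalize Nat.find hex = t at hle hspec hmin
  cases t with
  | zero => exact absurd hspec hu
  | succ t => exact ⟨t, by omega, hspec, fun r hr => hmin r (by omega)⟩

/-- Two tokens per white run split all the runs in the middle. -/
theorem exists_bisection (h : Paired B m) {U : Finset (Fin n)}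
    (hU : ∀ i, i ∈ U ↔ Sum.inl i ∈ B ∧ Sum.inl (finRotate n i) ∉ B) (hne : U.Nonempty) :
    ∃ m', m = m' + 1 ∧ ∃ T : Finset (CatVert n f), T.card ≤ 2 * U.card ∧
      Paired (B ∪ ↑T) m' ∧ ∃ w ∈ T, w ∉ B := by
  classical
  have hlen : ∀ u, ∃ t, u ∈ U → t + 3 ≤ 2 ^ (m + 1) ∧ Sum.inl ((finRotate n)^[t + 2] u) ∈ B ∧
      ∀ r ≤ t, (Sum.inl ((finRotate n)^[r + 1] u) : CatVert n f) ∉ B := by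
    intro u
    by_cases hu : u ∈ U
    · obtain ⟨t, ht⟩ := h.exists_run_length ((hU u).1 hu).2
      exact ⟨t, fun _ => ht⟩
    · exact ⟨0, fun h => absurd h hu⟩
  choose len hlen using hlen
  obtain ⟨u₀, hu₀⟩ := hne
  obtain ⟨m', rfl⟩ : ∃ m', m = m' + 1 := by
    cases m with
    | zero => have := (hlen u₀ hu₀).1; omega
    | succ m' => exact ⟨m', rfl⟩
  refine ⟨m', rfl,
    U.image (fun u => Sum.inl ((finRotate n)^[len u / 2 + 1] u)) ∪
      U.image (fun u => Sum.inl ((finRotate n)^[len u / 2 + 2] u)), ?_, ?_, ?_⟩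
  · refine (Finset.card_union_le _ _).trans ?_
    have h1 := Finset.card_image_le (s := U)
      (f := fun u => (Sum.inl ((finRotate n)^[len u / 2 + 1] u) : CatVert n f))
    have h2 := Finset.card_image_le (s := U)
      (f := fun u => (Sum.inl ((finRotate n)^[len u / 2 + 2] u) : CatVert n f))
    omega
  · constructor
    · intro i hi
      simp only [Finset.coe_union, Finset.coe_image, Set.mem_union, Set.mem_image,
        Finset.mem_coe] at hi ⊢
      rcases hi with hi | ⟨u, hu, hi⟩ | ⟨u, hu, hi⟩
      · exact (h.pair i hi).imp .inl .inl
      · refine .inr (.inr (.inr ⟨u, hu, ?_⟩))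
        rw [Function.iterate_succ_apply', Sum.inl.inj hi]
      · refine .inl (.inr (.inl ⟨u, hu, ?_⟩))
        rw [Function.iterate_succ_apply'] at hi
        rw [(finRotate n).injective (Sum.inl.inj hi)]
    · intro i
      have hpos : 1 ≤ 2 ^ m' := Nat.one_le_two_pow
      have hpow : 2 ^ (m' + 1 + 1) = 2 * 2 ^ (m' + 1) := by ring
      have hpow' : 2 ^ (m' + 1) = 2 * 2 ^ m' := by ring
      simp only [Finset.coe_union, Finset.coe_image, Set.mem_union, Set.mem_image,
        Finset.mem_coe]
      by_cases hi : Sum.inl i ∈ B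
      · exact ⟨0, by omega, .inl hi⟩
      obtain ⟨u, t, hu, rfl, hwhite⟩ := h.exists_run_start hi
      have huU : u ∈ U := (hU u).2 ⟨hu, hwhite 0 (by omega)⟩
      obtain ⟨hle, hend, -⟩ := hlen u huU
      have ht : t ≤ len u := by
        by_contra hlt
        exact hwhite (len u + 1) (by omega) hend
      rcases Nat.lt_or_ge (len u / 2) t with hlt | hge
      · rcases Nat.lt_or_ge (len u / 2 + 1) t with hlt' | hge'
        · refine ⟨len u + 1 - t, by omega, .inl ?_⟩
          rwa [← Function.iterate_add_apply, show len u + 1 - t + (t + 1) = len u + 2 by omega]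
        · refine ⟨0, by omega, .inr (.inr ⟨u, huU, ?_⟩)⟩
          rw [show t = len u / 2 + 1 by omega]
          rfl
      · refine ⟨len u / 2 - t, by omega, .inr (.inl ⟨u, huU, ?_⟩)⟩
        rw [← Function.iterate_add_apply,
          show len u / 2 - t + (t + 1) = len u / 2 + 1 by omega]
  · exact ⟨_, Finset.mem_union_left _ (Finset.mem_image_of_mem _ hu₀),
      (hlen u₀ hu₀).2.2 _ (by omega)⟩

end Paired

/-- If all centers are blue and each has at most one white leaf, Blue wins for free. -/
theorem win_of_subsingleton_leaves {q : ℕ} (hc : ∀ i, Sum.inl i ∈ B)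
    (hl : ∀ i j j', Sum.inr ⟨i, j⟩ ∉ B → Sum.inr ⟨i, j'⟩ ∉ B → j = j') :
    Win (catCycle n f) q B 0 := by
  induction hN : Bᶜ.ncard using Nat.strong_induction_on generalizing B with
  | _ N ih =>
  by_cases hall : ∀ v, v ∈ B
  · exact .all _ _ hall
  push Not at hall
  obtain ⟨v, hv⟩ := hall
  rcases v with i | ⟨i, j⟩
  · exact absurd (hc i) hv
  refine .rule2 _ _ (Sum.inl i) (Sum.inr ⟨i, j⟩)
    ⟨hc i, hv, trivial, adj_center_leaf.2 rfl, fun y hy hyB _ => ?_⟩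
    (ih _ (hN ▸ ncard_compl_insert_lt hv) (fun i => .inr (hc i))
      (fun i j j' h h' => hl i j j' (fun hB => h (.inr hB)) fun hB => h' (.inr hB)) rfl)
  rcases y with i' | ⟨i', j'⟩
  · exact absurd (hc i') hyB
  · obtain rfl : i = i' := adj_center_leaf.1 hy
    rw [hl i j' j hyB hv]

/-- If all centers are blue and at most `q` of them have white leaves, then `q * (k - 1)` tokens
suffice. -/
theorem win_of_centers {q k : ℕ} (hf : ∀ i, f i ≤ k) (hc : ∀ i, Sum.inl i ∈ B)
    {A : Finset (Fin n)} (hA : ∀ i j, Sum.inr ⟨i, j⟩ ∉ B → i ∈ A) (hcard : A.card ≤ q) :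
    Win (catCycle n f) q B (q * (k - 1)) := by
  classical
  let T : Finset (CatVert n f) :=
    (A.sigma fun i => Finset.univ.filter fun j : Fin (f i) => (j : ℕ) ≠ 0).map
      Function.Embedding.inr
  have hT : T.card ≤ q * (k - 1) := by
    rw [Finset.card_map, Finset.card_sigma]
    refine (Finset.sum_le_card_nsmul A _ (k - 1) fun i _ => ?_).trans ?_
    · have hsub : (Finset.univ.filter fun j : Fin (f i) => (j : ℕ) ≠ 0).card ≤
          (Finset.Ico 1 (f i)).card := by
        refine Finset.card_le_card_of_injOn (fun j => (j : ℕ)) (fun j hj => ?_)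
          (Fin.val_injective.injOn)
        have := j.isLt
        simp only [Finset.coe_filter, Finset.mem_univ, true_and, Set.mem_ofPred_eq] at hj
        simp only [Finset.coe_Ico, Set.mem_Ico]
        omega
      rw [Nat.card_Ico] at hsub
      have := hf i
      omega
    · exact Nat.mul_le_mul_right _ hcard
  have hwin : Win (catCycle n f) q (B ∪ ↑T) 0 := by
    refine win_of_subsingleton_leaves (fun i => .inl (hc i)) ?_
    have hzero : ∀ i (j : Fin (f i)), Sum.inr ⟨i, j⟩ ∉ B ∪ (T : Set (CatVert n f)) →
        (j : ℕ) = 0 := by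
      intro i j hj
      by_contra hne
      by_cases hB : Sum.inr ⟨i, j⟩ ∈ B
      · exact hj (.inl hB)
      · refine hj (.inr ?_)
        simp only [T, Finset.coe_map, Set.mem_image, Finset.mem_coe]
        exact ⟨⟨i, j⟩, by simp [hA i j hB, hne], rfl⟩
    intro i j j' h h'
    exact Fin.ext ((hzero i j h).trans (hzero i j' h').symm)
  exact (Win.of_union_finset T hwin).mono (by omega)

/-- Every position in which blue centers come in pairs is won with `p - 2` tokens per halving of
the white runs and `q * (k - 1)` tokens for the leaves. -/
theorem Paired.win {q k p m : ℕ} (hn : 2 ≤ n) (hf : ∀ i, f i ≤ k)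
    (hp : ∀ r, 2 * r ≤ q → 2 * r ≤ p - 2) (h : Paired B m) :
    Win (catCycle n f) q B ((p - 2) * m + q * (k - 1)) := by
  classical
  induction hN : Bᶜ.ncard using Nat.strong_induction_on generalizing B m with
  | _ N ih =>
  let s := finRotate n
  let U : Finset (Fin n) := Finset.univ.filter fun i =>
    Sum.inl i ∈ B ∧ Sum.inl (s i) ∉ B
  have hU : ∀ i, i ∈ U ↔ Sum.inl i ∈ B ∧ Sum.inl (finRotate n i) ∉ B := by simp [U, s]
  let A : Finset (Fin n) := Finset.univ.filter fun i =>
    Sum.inl i ∈ B ∧ Sum.inl (s.symm i) ∈ B ∧ ∃ j, Sum.inr ⟨i, j⟩ ∉ B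
  have hA : ∀ i, i ∈ A ↔ Sum.inl i ∈ B ∧ Sum.inl (s.symm i) ∈ B ∧ ∃ j, Sum.inr ⟨i, j⟩ ∉ B := by
    simp [A]
  have hprev : ∀ u ∈ U, Sum.inl (s.symm u) ∈ B := by
    intro u hu
    obtain ⟨h1, h2⟩ := (hU u).1 hu
    have := h.pair (s.symm u)
    simp only [s, Equiv.apply_symm_apply] at this
    exact (this h1).resolve_right h2
  by_cases hUA : U ⊆ A
  · by_cases hcard : q + 1 ≤ U.card + A.card
    · have hy : ∀ i, ∃ y : CatVert n f, i ∈ A → y ∉ B ∧ ∃ j, y = Sum.inr ⟨i, j⟩ := by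
        intro i
        by_cases hi : i ∈ A
        · obtain ⟨-, -, j, hj⟩ := (hA i).1 hi
          exact ⟨_, fun _ => ⟨hj, j, rfl⟩⟩
        · exact ⟨Sum.inl i, fun h => absurd h hi⟩
      choose leaf hleaf using hy
      let run : Fin n → Set (CatVert n f) := fun u =>
        WhiteComp (catCycle n f) B (Sum.inl (s u))
      have hleaf_notMem : ∀ {i j}, Sum.inl i ∈ B → ∀ u, Sum.inr ⟨i, j⟩ ∉ run u :=
        fun hi u hmem => Sum.inl_ne_inr (eq_of_leaf_mem_whiteComp (l := ⟨_, _⟩) hi hmem)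
      have hdisj : Disjoint (U.image run) (A.image fun i => {leaf i}) := by
        rw [Finset.disjoint_left]
        intro W hW hW'
        obtain ⟨u, -, rfl⟩ := Finset.mem_image.1 hW
        obtain ⟨i, hi, hiW⟩ := Finset.mem_image.1 hW'
        obtain ⟨-, j, hj⟩ := hleaf i hi
        refine hleaf_notMem (j := j) ((hA i).1 hi).1 u ?_
        rw [← hiW, hj]
        exact rfl
      have hleaf_inj : Set.InjOn leaf A := by
        intro i hi i' hi' h
        obtain ⟨-, j, hj⟩ := hleaf i hi
        obtain ⟨-, j', hj'⟩ := hleaf i' hi'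
        rw [hj, hj'] at h
        exact congrArg Sigma.fst (Sum.inr.inj h)
      refine Win.of_announce (U.image run ∪ A.image fun i => {leaf i}) ?_ ?_ ?_
      · intro W hW
        rcases Finset.mem_union.1 hW with hW | hW
        · obtain ⟨u, hu, rfl⟩ := Finset.mem_image.1 hW
          exact ⟨_, ((hU u).1 hu).2, rfl⟩
        · obtain ⟨i, hi, rfl⟩ := Finset.mem_image.1 hW
          obtain ⟨hB, j, hj⟩ := hleaf i hi
          exact ⟨_, hB, by rw [hj, whiteComp_leaf (l := ⟨i, j⟩) ((hA i).1 hi).1]⟩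
      · rw [Finset.card_union_of_disjoint hdisj, Finset.card_image_of_injOn,
          Finset.card_image_of_injOn]
        · exact hcard
        · exact fun i hi i' hi' h => hleaf_inj hi hi' (Set.singleton_injective h)
        · exact fun u hu u' hu' h =>
            eq_of_whiteComp_eq ((hU u).1 hu).1 ((hU u).1 hu).2 ((hU u').1 hu').1 h
      · intro 𝒮 hS hne
        have hleaf_mem : ∀ {i j}, Sum.inl i ∈ B →
            Sum.inr ⟨i, j⟩ ∈ ⋃₀ (𝒮 : Set (Set (CatVert n f))) → i ∈ A ∧ Sum.inr ⟨i, j⟩ = leaf i := by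
          rintro i j hi ⟨W, hW, hmem⟩
          rcases Finset.mem_union.1 (hS hW) with hW | hW
          · obtain ⟨u, -, rfl⟩ := Finset.mem_image.1 hW
            exact absurd hmem (hleaf_notMem hi u)
          · obtain ⟨i', hi', rfl⟩ := Finset.mem_image.1 hW
            obtain ⟨-, j', hj'⟩ := hleaf i' hi'
            have heq : Sum.inr ⟨i, j⟩ = leaf i' := hmem
            obtain rfl : i = i' := congrArg Sigma.fst (Sum.inr.inj (heq.trans hj'))
            exact ⟨hi', heq⟩
        by_cases hrun : ∃ u ∈ U, run u ∈ 𝒮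
        · obtain ⟨u, hu, huS⟩ := hrun
          obtain ⟨t, -, hend, hwhite⟩ := h.exists_run_length ((hU u).1 hu).2
          have hlast := hwhite t le_rfl
          rw [Function.iterate_succ_apply'] at hend
          refine ⟨Sum.inl (s (s^[t + 1] u)), Sum.inl (s^[t + 1] u),
            ⟨hend, hlast, ⟨_, huS, iterate_mem_whiteComp hn hwhite⟩,
              (adj_center_next hn _).symm, fun y hy hyB hyS => ?_⟩,
            ih _ (hN ▸ ncard_compl_insert_lt hlast) (h.insert_center (.inl hend)) rfl⟩
          rcases y with i | ⟨i, j⟩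
          · rcases adj_center_center hy with rfl | hi
            · exact absurd ((h.pair _ hend).resolve_left hlast) hyB
            · rw [s.injective hi]
          · obtain rfl := adj_center_leaf.1 hy
            have := ((hA _).1 (hleaf_mem hend hyS).1).2.1
            rw [Equiv.symm_apply_apply] at this
            exact absurd this hlast
        · obtain ⟨W, hW⟩ := hne
          rcases Finset.mem_union.1 (hS hW) with hW' | hW'
          · obtain ⟨u, hu, rfl⟩ := Finset.mem_image.1 hW'
            exact absurd ⟨u, hu, hW⟩ hrun
          obtain ⟨i, hi, rfl⟩ := Finset.mem_image.1 hW'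
          obtain ⟨hB, j, hj⟩ := hleaf i hi
          have hiB := ((hA i).1 hi).1
          refine ⟨Sum.inl i, leaf i,
            ⟨hiB, hB, ⟨_, hW, rfl⟩, hj ▸ adj_center_leaf.2 rfl, fun y hy hyB hyS => ?_⟩,
            ih _ (hN ▸ ncard_compl_insert_lt hB) (hj ▸ h.insert_leaf _) rfl⟩
          rcases y with i' | ⟨i', j'⟩
          · obtain ⟨W', hW', hmem⟩ := hyS
            rcases Finset.mem_union.1 (hS hW') with hW'' | hW''
            · obtain ⟨u, hu, rfl⟩ := Finset.mem_image.1 hW''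
              exact absurd ⟨u, hu, hW'⟩ hrun
            · obtain ⟨c, hc, rfl⟩ := Finset.mem_image.1 hW''
              obtain ⟨-, j', hj'⟩ := hleaf c hc
              exact absurd ((show Sum.inl i' = leaf c from hmem).trans hj') Sum.inl_ne_inr
          · obtain rfl : i = i' := adj_center_leaf.1 hy
            exact (hleaf_mem hiB hyS).2
    · have hle : 2 * U.card ≤ q := by
        have := Finset.card_le_card hUA
        omega
      rcases U.eq_empty_or_nonempty with hemp | hne
      · have hc : ∀ i, Sum.inl i ∈ B := by
          intro i
          by_contra hi
          obtain ⟨u, t, hu, -, hw⟩ := h.exists_run_start hi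
          have : u ∈ U := (hU u).2 ⟨hu, hw 0 (by omega)⟩
          simp [hemp] at this
        exact (win_of_centers hf hc (A := A)
          (fun i j hj => (hA i).2 ⟨hc _, hc _, j, hj⟩) (by omega)).mono (by omega)
      · obtain ⟨m', rfl, T, hT, hpair, w, hwT, hwB⟩ := h.exists_bisection hU hne
        refine (Win.of_union_finset T (ih _ ?_ hpair rfl)).mono ?_
        · rw [← hN]
          exact Set.ncard_lt_ncard ⟨Set.compl_subset_compl.2 Set.subset_union_left,
            fun hsub => hsub hwB (.inr hwT)⟩
        · have := hp _ hle
          rw [mul_add, mul_one]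
          omega
  · obtain ⟨u, huU, huA⟩ := Finset.not_subset.1 hUA
    obtain ⟨hu, hu'⟩ := (hU u).1 huU
    have hleaf : ∀ j, Sum.inr ⟨u, j⟩ ∈ B := by
      intro j
      by_contra hj
      exact huA ((hA u).2 ⟨hu, hprev u huU, j, hj⟩)
    refine .rule2 _ _ (Sum.inl u) (Sum.inl (s u))
      ⟨hu, hu', trivial, adj_center_next hn u, fun y hy hyB _ => ?_⟩
      (ih _ (hN ▸ ncard_compl_insert_lt hu') (h.insert_center (.inr ⟨u, rfl, hu⟩)) rfl)
    rcases y with i | ⟨i, j⟩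
    · rcases adj_center_center hy with rfl | rfl
      · rfl
      · have := hprev _ huU
        simp only [s, Equiv.symm_apply_apply] at this
        exact absurd this hyB
    · obtain rfl : u = i := adj_center_leaf.1 hy
      exact absurd (hleaf j) hyB

/-- Two adjacent centers form a paired position. -/
theorem paired_initial {m : ℕ} (hn : 2 ≤ n) (hm : n ≤ 2 ^ (m + 1)) :
    Paired (f := f) ({Sum.inl ⟨0, by omega⟩, Sum.inl ⟨1, by omega⟩} : Set (CatVert n f)) m where
  pair i hi := by
    simp only [Set.mem_insert_iff, Set.mem_singleton_iff, Sum.inl.injEq, Fin.ext_iff] at hi ⊢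
    have hr := val_finRotate i
    have hr' := val_finRotate (finRotate n i)
    rcases hi with hi | hi
    · right; right
      rw [hr', hi]
      exact Nat.mod_eq_of_lt (by omega)
    · left; left
      rw [hr] at hi
      have := i.isLt
      rcases Nat.lt_or_ge (i + 1) n with h2 | h2
      · rw [Nat.mod_eq_of_lt h2] at hi
        omega
      · rw [show (i : ℕ) + 1 = n by omega, Nat.mod_self] at hi
        omega
  gap i := by
    simp only [Set.mem_insert_iff, Set.mem_singleton_iff, Sum.inl.injEq, Fin.ext_iff,
      val_finRotate_iterate]
    have := i.isLt
    rcases Nat.lt_or_ge i 2 with h2 | h2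
    · refine ⟨0, by omega, ?_⟩
      rw [add_zero, Nat.mod_eq_of_lt i.isLt]
      omega
    · refine ⟨n - i, by omega, .inl ?_⟩
      rw [show (i : ℕ) + (n - i) = n by omega, Nat.mod_self]

end Caterpillar

end ZqGame

open SimpleGraph

/-- Upper bound for `q ≥ 2` on caterpillar cycles: with `p = q + 1 + x` where
`x ∈ {0,1}` and `x ≡ q + 1 (mod 2)` (so `p` is even),
`Z_q(C_{n,k}) ≤ (p - 2) log₂ n + p + k - q + q(k - 1)`. -/
theorem Zq_catCycle_upper (n k q x p : ℕ) (hn : 3 ≤ n) (hk : 2 ≤ k) (hq : 2 ≤ q)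
    (f : Fin n → ℕ) (hf : ∀ i, 2 ≤ f i ∧ f i ≤ k)
    (hx : x = (q + 1) % 2) (hp : p = q + 1 + x) :
    (ZqGame.Zq (ZqGame.catCycle n f) q : ℝ) ≤
      ((p : ℝ) - 2) * Real.logb 2 n + p + k - q + q * ((k : ℝ) - 1) := by
  obtain ⟨m, hm, hlog⟩ : ∃ m : ℕ, n ≤ 2 ^ (m + 1) ∧ 2 ^ m ≤ n := by
    refine ⟨Nat.log 2 n, (Nat.lt_pow_succ_log_self (by norm_num) n).le,
      Nat.pow_log_le_self 2 (by omega)⟩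
  have hwin := (ZqGame.paired_initial (f := f) (by omega) hm).win (q := q) (p := p) (by omega)
    (fun i => (hf i).2) (fun r hr => by omega)
  have hwin' : ZqGame.Win (ZqGame.catCycle n f) q ∅ ((p - 2) * m + q * (k - 1) + 2) :=
    .rule1 _ _ (Sum.inl ⟨1, by omega⟩) (.rule1 _ _ (Sum.inl ⟨0, by omega⟩) (by simpa using hwin))
  have hle : ZqGame.Zq (ZqGame.catCycle n f) q ≤ (p - 2) * m + q * (k - 1) + 2 := Nat.sInf_le hwin'
  have hmlog : (m : ℝ) ≤ Real.logb 2 n := by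
    rw [Real.le_logb_iff_rpow_le (by norm_num) (by exact_mod_cast (by omega : 0 < n)),
      Real.rpow_natCast]
    exact_mod_cast hlog
  have hleR : (ZqGame.Zq (ZqGame.catCycle n f) q : ℝ) ≤
      ((p : ℝ) - 2) * m + q * ((k : ℝ) - 1) + 2 := by
    have : (ZqGame.Zq (ZqGame.catCycle n f) q : ℝ) ≤
      (((p - 2) * m + q * (k - 1) + 2 : ℕ) : ℝ) := by exact_mod_cast hle
    push_cast [Nat.cast_sub (show 2 ≤ p by omega), Nat.cast_sub (show 1 ≤ k by omega)] at this
    exact this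
  have hp2 : (0 : ℝ) ≤ (p : ℝ) - 2 := by
    have : (2 : ℝ) ≤ p := by exact_mod_cast (by omega : 2 ≤ p)
    linarith
  have hslack : (q : ℝ) + 2 ≤ p + k := by exact_mod_cast (by omega : q + 2 ≤ p + k)
  have := mul_le_mul_of_nonneg_left hmlog hp2
  linarith
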